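/- For every u ∈ C²(ℝ^d) with ∫ |∇u(x)|² dπ(x) < ∞ and ∫ ‖∇²u(x)‖_F² dπ(x) < ∞ (Frobenius norm of the Hessian), one has ∫ |∇u(x)|² |∇U(x)|² dπ(x) ≤ 16 ∫ ‖∇²u(x)‖_F² dπ(x) + 4 C_U d^{1+ω} ∫ |∇u(x)|² dπ(x). -/

import Mathlib

open MeasureTheory Real
open scoped RealInnerProductSpace

/-- The Laplacian of `U`, defined as the sum of second partial derivatives. -/
noncomputable def lapl (d : ℕ) (U : EuclideanSpace ℝ (Fin d) → ℝ)
    (x : EuclideanSpace ℝ (Fin d)) : ℝ :=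
  ∑ i : Fin d,
    fderiv ℝ (fun y => fderiv ℝ U y (EuclideanSpace.single i 1)) x (EuclideanSpace.single i 1)

/-- The Gibbs probability measure `π` with density `Z⁻¹ e^{-U}` w.r.t. Lebesgue measure. -/
noncomputable def gibbs (d : ℕ) (U : EuclideanSpace ℝ (Fin d) → ℝ) (Z : ℝ) :
    Measure (EuclideanSpace ℝ (Fin d)) :=
  volume.withDensity (fun x => ENNReal.ofReal (Real.exp (-U x) / Z))

/-- Squared Frobenius norm of the Hessian of `u`. -/
noncomputable def hessFS (d : ℕ) (u : EuclideanSpace ℝ (Fin d) → ℝ)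
    (x : EuclideanSpace ℝ (Fin d)) : ℝ :=
  ∑ i : Fin d, ∑ j : Fin d,
    (fderiv ℝ (fun y => fderiv ℝ u y (EuclideanSpace.single j 1)) x
      (EuclideanSpace.single i 1)) ^ 2

/-- Divergence of a vector field `F`. -/
noncomputable def diverg (d : ℕ)
    (F : EuclideanSpace ℝ (Fin d) → EuclideanSpace ℝ (Fin d))
    (x : EuclideanSpace ℝ (Fin d)) : ℝ :=
  ∑ i : Fin d, fderiv ℝ (fun y => F y i) x (EuclideanSpace.single i 1)

/-- Partial derivative in the direction of the `i`-th basis vector. -/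
noncomputable def pd (d : ℕ) (f : EuclideanSpace ℝ (Fin d) → ℝ) (i : Fin d)
    (x : EuclideanSpace ℝ (Fin d)) : ℝ := fderiv ℝ f x (EuclideanSpace.single i 1)

lemma norm_gradient_sq (d : ℕ) (f : EuclideanSpace ℝ (Fin d) → ℝ)
    (x : EuclideanSpace ℝ (Fin d)) : ‖gradient f x‖ ^ 2 = ∑ i, (pd d f i x) ^ 2 := by
  rw [EuclideanSpace.norm_sq_eq]
  refine Finset.sum_congr rfl fun i _ => ?_
  unfold pd
  rw [← toDual_gradient, InnerProductSpace.toDual_apply_apply, EuclideanSpace.inner_single_right]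
  simp

lemma norm_gradient_eq (d : ℕ) (f : EuclideanSpace ℝ (Fin d) → ℝ)
    (x : EuclideanSpace ℝ (Fin d)) : ‖gradient f x‖ = ‖fderiv ℝ f x‖ := by
  simp [gradient]

lemma pd_contDiff (d : ℕ) (f : EuclideanSpace ℝ (Fin d) → ℝ) (hf : ContDiff ℝ 2 f) (i : Fin d) :
    ContDiff ℝ 1 (pd d f i) := by
  have : ContDiff ℝ 1 (fderiv ℝ f) := hf.fderiv_right (by norm_num)
  exact this.clm_apply contDiff_const

lemma pd_continuous (d : ℕ) (f : EuclideanSpace ℝ (Fin d) → ℝ) (hf : ContDiff ℝ 1 f) (i : Fin d) :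
    Continuous (pd d f i) := by
  have : Continuous (fderiv ℝ f) := hf.continuous_fderiv (by norm_num)
  exact this.clm_apply continuous_const

lemma integral_pd_zero (d : ℕ) (F : EuclideanSpace ℝ (Fin d) → ℝ) (hF : ContDiff ℝ 1 F)
    (hc : HasCompactSupport F) (i : Fin d) :
    Integrable (pd d F i) ∧ ∫ x, pd d F i x = 0 := by
  have h1 : Integrable (pd d F i) :=
    (pd_continuous d F hF i).integrable_of_hasCompactSupport (hc.fderiv_apply ℝ _)
  refine ⟨h1, ?_⟩
  have := integral_mul_fderiv_eq_neg_fderiv_mul_of_integrable (μ := volume)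
    (f := fun _ : EuclideanSpace ℝ (Fin d) => (1 : ℝ)) (g := F) (v := EuclideanSpace.single i 1)
    (by simp) (by simpa only [one_mul] using! h1)
    (by simpa using hF.continuous.integrable_of_hasCompactSupport hc)
    (fun x _ => by fun_prop) (fun x _ => hF.differentiable (by norm_num) x)
  simpa [pd] using this

lemma alg_ineq {d : ℕ} (a b c : Fin d → ℝ) (h : Fin d → Fin d → ℝ) (t ε : ℝ)
    (ht0 : 0 ≤ t) (ht1 : t ≤ 1) (hε : 0 ≤ ε) (hc : ∑ i, c i ^ 2 ≤ ε ^ 2) :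
    ∑ i, b i * (2 * t * c i * (∑ j, a j ^ 2) + t ^ 2 * ∑ j, 2 * a j * h i j)
      ≤ t ^ 2 * (∑ j, a j ^ 2) * (∑ i, b i ^ 2) / 4
        + 4 * ((1 + ε) * (∑ i, ∑ j, h i j ^ 2) + (ε ^ 2 + ε) * ∑ j, a j ^ 2) := by
  set G := ∑ j, a j ^ 2 with hG
  set B := ∑ j, b j ^ 2 with hB
  set H := ∑ i, ∑ j, h i j ^ 2 with hH
  have G0 : 0 ≤ G := Finset.sum_nonneg fun _ _ => sq_nonneg _
  have B0 : 0 ≤ B := Finset.sum_nonneg fun _ _ => sq_nonneg _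
  have H0 : 0 ≤ H := Finset.sum_nonneg fun _ _ => Finset.sum_nonneg fun _ _ => sq_nonneg _
  have hp : ∑ i, b i * c i ≤ √B * ε := by
    refine (Real.sum_mul_le_sqrt_mul_sqrt _ b c).trans ?_
    gcongr
    exact Real.sqrt_le_iff.2 ⟨hε, hc⟩
  have hq : ∑ i, ∑ j, b i * a j * h i j ≤ √B * √G * √H := by
    have e1 : ∑ i, ∑ j, b i * a j * h i j = ∑ i, b i * ∑ j, a j * h i j := by
      simp only [Finset.mul_sum, mul_assoc]
    rw [e1, mul_assoc, ← Real.sqrt_mul G0]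
    refine (Real.sum_mul_le_sqrt_mul_sqrt _ b _).trans ?_
    gcongr
    rw [hH, Finset.mul_sum]
    exact Finset.sum_le_sum fun i _ => Finset.sum_mul_sq_le_sq_mul_sq _ a (h i)
  have e : ∑ i, b i * (2 * t * c i * G + t ^ 2 * ∑ j, 2 * a j * h i j)
      = 2 * t * G * (∑ i, b i * c i) + 2 * t ^ 2 * ∑ i, ∑ j, b i * a j * h i j := by
    simp only [mul_add, Finset.mul_sum, Finset.sum_add_distrib]
    congr 1
    · exact Finset.sum_congr rfl fun i _ => by ring
    · exact Finset.sum_congr rfl fun i _ => Finset.sum_congr rfl fun j _ => by ring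
  rw [e]
  have sG := Real.sq_sqrt G0
  have sB := Real.sq_sqrt B0
  have sH := Real.sq_sqrt H0
  have nG := Real.sqrt_nonneg G
  have nB := Real.sqrt_nonneg B
  have nH := Real.sqrt_nonneg H
  set g := √G
  set β := √B
  set k := √H
  rw [← sG, ← sB, ← sH]
  have i1 : 2 * t * g ^ 2 * (∑ i, b i * c i) ≤ 2 * t * g ^ 2 * (β * ε) := by gcongr
  have i2 : 2 * t ^ 2 * (∑ i, ∑ j, b i * a j * h i j) ≤ 2 * t ^ 2 * (β * g * k) := by gcongr
  have i3 : 2 * (t * β * g) * (ε * g + t * k) ≤ (t * β * g) ^ 2 / 4 + 4 * (ε * g + t * k) ^ 2 := by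
    nlinarith [sq_nonneg ((t * β * g) / 2 - 2 * (ε * g + t * k))]
  have i4 : (ε * g + t * k) ^ 2 ≤ (ε * g + k) ^ 2 := by
    have : t * k ≤ k := mul_le_of_le_one_left nH ht1
    gcongr
  nlinarith [mul_nonneg hε (sq_nonneg (g - k))]

lemma divF (d : ℕ) (U u χ : EuclideanSpace ℝ (Fin d) → ℝ) (Z : ℝ)
    (hU : ContDiff ℝ 2 U) (hu : ContDiff ℝ 2 u) (hχ : ContDiff ℝ 1 χ)
    (i : Fin d) (x : EuclideanSpace ℝ (Fin d)) :
    pd d (fun x => χ x ^ 2 * (∑ j, pd d u j x ^ 2) * pd d U i x * (Real.exp (-U x) / Z)) i x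
     = (Real.exp (-U x) / Z) * (pd d U i x * (2 * χ x * pd d χ i x * (∑ j, pd d u j x ^ 2)
        + χ x ^ 2 * ∑ j, 2 * pd d u j x * pd d (pd d u j) i x)
        + χ x ^ 2 * (∑ j, pd d u j x ^ 2) * pd d (pd d U i) i x
        - χ x ^ 2 * (∑ j, pd d u j x ^ 2) * pd d U i x ^ 2) := by
  have h1 := (hχ.differentiable (by norm_num) x).hasFDerivAt
  have h2 := (hU.differentiable (by norm_num) x).hasFDerivAt
  have h3 := ((pd_contDiff d U hU i).differentiable (by norm_num) x).hasFDerivAt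
  have h4 := fun j => ((pd_contDiff d u hu j).differentiable (by norm_num) x).hasFDerivAt
  have h5 := HasFDerivAt.fun_sum (u := Finset.univ) (fun j _ => (h4 j).pow 2)
  have h6 := ((((h1.pow 2).mul h5).mul h3).mul (h2.neg.exp.mul_const Z⁻¹))
  have : pd d (fun x => χ x ^ 2 * (∑ j, pd d u j x ^ 2) * pd d U i x * (Real.exp (-U x) / Z)) i x
    = _ := congrArg (fun L => L (EuclideanSpace.single i 1)) h6.fderiv
  rw [this]
  simp [div_eq_mul_inv]
  simp only [← pd.eq_def]
  ring


lemma rho_cont (d : ℕ) (U : EuclideanSpace ℝ (Fin d) → ℝ) (Z : ℝ) (hU : Continuous U) :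
    Continuous fun x => Real.exp (-U x) / Z := by fun_prop

lemma gibbs_integrable (d : ℕ) (U : EuclideanSpace ℝ (Fin d) → ℝ) (Z : ℝ) (hU : Continuous U)
    (hZ : 0 < Z) (f : EuclideanSpace ℝ (Fin d) → ℝ) :
    Integrable f (gibbs d U Z) ↔ Integrable (fun x => Real.exp (-U x) / Z * f x) := by
  unfold gibbs
  rw [integrable_withDensity_iff_integrable_smul' (rho_cont d U Z hU).measurable.ennreal_ofReal
    (by simp)]
  refine iff_of_eq (congrArg (fun g => Integrable g volume) (funext fun x => ?_))
  rw [ENNReal.toReal_ofReal (by positivity), smul_eq_mul]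

lemma gibbs_integral (d : ℕ) (U : EuclideanSpace ℝ (Fin d) → ℝ) (Z : ℝ) (hU : Continuous U)
    (hZ : 0 < Z) (f : EuclideanSpace ℝ (Fin d) → ℝ) :
    ∫ x, f x ∂(gibbs d U Z) = ∫ x, Real.exp (-U x) / Z * f x := by
  unfold gibbs
  rw [integral_withDensity_eq_integral_toReal_smul₀
    (rho_cont d U Z hU).measurable.ennreal_ofReal.aemeasurable (by simp)]
  refine integral_congr_ae (Filter.Eventually.of_forall fun x => ?_)
  simp only [smul_eq_mul]
  rw [ENNReal.toReal_ofReal (by positivity)]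

lemma cutoff_ineq (d : ℕ) (U u χ : EuclideanSpace ℝ (Fin d) → ℝ) (Z K ε : ℝ)
    (hU : ContDiff ℝ 2 U) (hZ : 0 < Z) (hK : 0 ≤ K) (hε : 0 ≤ ε)
    (hLap : ∀ x, lapl d U x ≤ K + ‖gradient U x‖ ^ 2 / 2)
    (hu : ContDiff ℝ 2 u)
    (hgradu2 : Integrable (fun x => ‖gradient u x‖ ^ 2) (gibbs d U Z))
    (hhess2 : Integrable (fun x => hessFS d u x) (gibbs d U Z))
    (hχ : ContDiff ℝ 1 χ) (hχc : HasCompactSupport χ) (hχ0 : ∀ x, 0 ≤ χ x) (hχ1 : ∀ x, χ x ≤ 1)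
    (hχε : ∀ x, ‖gradient χ x‖ ≤ ε) :
    Integrable (fun x => χ x ^ 2 * (‖gradient u x‖ ^ 2 * ‖gradient U x‖ ^ 2)) (gibbs d U Z) ∧
    ∫ x, χ x ^ 2 * (‖gradient u x‖ ^ 2 * ‖gradient U x‖ ^ 2) ∂(gibbs d U Z) ≤
      16 * (1 + ε) * (∫ x, hessFS d u x ∂(gibbs d U Z))
        + (16 * (ε ^ 2 + ε) + 4 * K) * ∫ x, ‖gradient u x‖ ^ 2 ∂(gibbs d U Z) := by
  have hUc := hU.continuous
  rw [gibbs_integrable d U Z hUc hZ] at hgradu2 hhess2 ⊢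
  simp only [gibbs_integral d U Z hUc hZ]
  have cu := fun i => (pd_contDiff d u hu i).continuous
  have cU := fun i => (pd_contDiff d U hU i).continuous
  have cρ := rho_cont d U Z hUc
  have hL : Integrable (fun x => Real.exp (-U x) / Z *
      (χ x ^ 2 * (‖gradient u x‖ ^ 2 * ‖gradient U x‖ ^ 2))) := by
    simp only [norm_gradient_sq]
    have cχ := hχ.continuous
    refine Continuous.integrable_of_hasCompactSupport (by fun_prop) ?_
    refine hχc.mono fun x hx hx0 => hx ?_
    simp [hx0]
  refine ⟨hL, ?_⟩
  set F : Fin d → EuclideanSpace ℝ (Fin d) → ℝ := fun i x =>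
    χ x ^ 2 * (∑ j, pd d u j x ^ 2) * pd d U i x * (Real.exp (-U x) / Z) with hF
  have hFi : ∀ i, Integrable (pd d (F i) i) ∧ ∫ x, pd d (F i) i x = 0 := by
    intro i
    refine integral_pd_zero d _ ?_ ?_ i
    · have h1 := fun i => pd_contDiff d u hu i
      have h2 := pd_contDiff d U hU i
      have h3 : ContDiff ℝ 1 U := hU.of_le (by norm_num)
      have h4 : ContDiff ℝ 1 fun x => ∑ j, pd d u j x ^ 2 :=
        ContDiff.sum fun j _ => (h1 j).pow 2
      exact (((hχ.pow 2).mul h4).mul h2).mul (h3.neg.exp.div_const Z)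
    · refine hχc.mono fun x hx hx0 => hx ?_
      simp [hF, hx0]
  have hS : Integrable (fun x => ∑ i, pd d (F i) i x) := integrable_finsetSum _ fun i _ => (hFi i).1
  have hS0 : ∫ x, ∑ i, pd d (F i) i x = 0 := by
    rw [integral_finsetSum _ fun i _ => (hFi i).1]
    exact Finset.sum_eq_zero fun i _ => (hFi i).2
  have key : ∀ x, Real.exp (-U x) / Z * (χ x ^ 2 * (‖gradient u x‖ ^ 2 * ‖gradient U x‖ ^ 2)) ≤
      16 * (1 + ε) * (Real.exp (-U x) / Z * hessFS d u x)
        + (16 * (ε ^ 2 + ε) + 4 * K) * (Real.exp (-U x) / Z * ‖gradient u x‖ ^ 2)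
        - 4 * ∑ i, pd d (F i) i x := by
    intro x
    have hρ : 0 ≤ Real.exp (-U x) / Z := by positivity
    have hc := hχε x
    have hc2 : ∑ i, pd d χ i x ^ 2 ≤ ε ^ 2 := by
      rw [← norm_gradient_sq]; gcongr
    have A := alg_ineq (fun i => pd d u i x) (fun i => pd d U i x) (fun i => pd d χ i x)
      (fun i j => pd d (pd d u j) i x) (χ x) ε (hχ0 x) (hχ1 x) hε hc2
    have hH : hessFS d u x = ∑ i, ∑ j, pd d (pd d u j) i x ^ 2 := rfl
    have hl : lapl d U x = ∑ i, pd d (pd d U i) i x := rfl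
    have hL := hLap x
    have hdiv : ∑ i, pd d (F i) i x = (Real.exp (-U x) / Z) *
      ((∑ i, pd d U i x * (2 * χ x * pd d χ i x * (∑ j, pd d u j x ^ 2)
        + χ x ^ 2 * ∑ j, 2 * pd d u j x * pd d (pd d u j) i x))
        + χ x ^ 2 * (∑ j, pd d u j x ^ 2) * lapl d U x
        - χ x ^ 2 * (∑ j, pd d u j x ^ 2) * ∑ i, pd d U i x ^ 2) := by
      simp only [hF, divF d U u χ Z hU hu hχ, hl]
      rw [← Finset.mul_sum, Finset.sum_sub_distrib, Finset.sum_add_distrib, ← Finset.mul_sum,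
        ← Finset.mul_sum]
    rw [hdiv, hH]
    rw [norm_gradient_sq] at hL ⊢
    rw [norm_gradient_sq]
    have G0 : 0 ≤ ∑ j, pd d u j x ^ 2 := Finset.sum_nonneg fun _ _ => sq_nonneg _
    set T := ∑ i, pd d U i x * (2 * χ x * pd d χ i x * (∑ j, pd d u j x ^ 2)
        + χ x ^ 2 * ∑ j, 2 * pd d u j x * pd d (pd d u j) i x)
    set G := ∑ j, pd d u j x ^ 2
    set B := ∑ j, pd d U j x ^ 2
    set H := ∑ i, ∑ j, pd d (pd d u j) i x ^ 2
    set ρ := Real.exp (-U x) / Z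
    have hL' : χ x ^ 2 * G * lapl d U x ≤ χ x ^ 2 * G * (K + B / 2) := by gcongr
    have hχG : χ x ^ 2 * G * K ≤ G * K := by
      have : χ x ^ 2 ≤ 1 := pow_le_one₀ (hχ0 x) (hχ1 x)
      have := mul_le_mul_of_nonneg_right this (mul_nonneg G0 hK)
      linarith
    have : χ x ^ 2 * (G * B) ≤ 16 * (1 + ε) * H + (16 * (ε ^ 2 + ε) + 4 * K) * G
        - 4 * (T + χ x ^ 2 * G * lapl d U x - χ x ^ 2 * G * B) := by
      nlinarith
    have := mul_le_mul_of_nonneg_left this hρ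
    linarith
  have hi1 := hhess2.const_mul (16 * (1 + ε))
  have hi2 := hgradu2.const_mul (16 * (ε ^ 2 + ε) + 4 * K)
  have hi3 := hS.const_mul 4
  have := integral_mono hL ((hi1.add hi2).sub hi3) key
  rw [integral_sub' (hi1.add hi2) hi3, integral_add' hi1 hi2, integral_const_mul, integral_const_mul,
    integral_const_mul, hS0] at this
  linarith

lemma exists_cutoff (d : ℕ) : ∃ (χ : ℕ → EuclideanSpace ℝ (Fin d) → ℝ) (ε : ℕ → ℝ),
    (∀ n, ContDiff ℝ 1 (χ n)) ∧ (∀ n, HasCompactSupport (χ n)) ∧ (∀ n x, 0 ≤ χ n x) ∧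
    (∀ n x, χ n x ≤ 1) ∧ (∀ n x, ‖gradient (χ n) x‖ ≤ ε n) ∧ (∀ n, 0 ≤ ε n) ∧
    Filter.Tendsto ε Filter.atTop (nhds 0) ∧
    (∀ x, ∀ᶠ n in Filter.atTop, χ n x = 1) := by
  let f : ContDiffBump (0 : EuclideanSpace ℝ (Fin d)) := ⟨1, 2, by norm_num, by norm_num⟩
  have hf : ContDiff ℝ 1 f := f.contDiff
  obtain ⟨C, hC⟩ := (hf.continuous_fderiv (by norm_num)).bounded_above_of_compact_support
    (f.hasCompactSupport.fderiv ℝ)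
  have C0 : 0 ≤ C := (norm_nonneg _).trans (hC 0)
  have hn : ∀ n : ℕ, (0 : ℝ) < (n : ℝ) + 1 := fun n => by positivity
  refine ⟨fun n x => f (((n : ℝ) + 1)⁻¹ • x), fun n => C * ((n : ℝ) + 1)⁻¹, ?_, ?_, ?_, ?_, ?_, ?_,
    ?_, ?_⟩
  · intro n; exact hf.comp (contDiff_const_smul _)
  · intro n
    exact f.hasCompactSupport.comp_smul (inv_ne_zero (hn n).ne')
  · intro n x; exact f.nonneg
  · intro n x; exact f.le_one
  · intro n x
    rw [norm_gradient_eq]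
    have h1 := (hf.differentiable (by norm_num) (((n : ℝ) + 1)⁻¹ • x)).hasFDerivAt
    have h2 := h1.comp x ((hasFDerivAt_id x).const_smul (((n : ℝ) + 1)⁻¹))
    have h3 : fderiv ℝ (fun x => f (((n : ℝ) + 1)⁻¹ • x)) x = _ := h2.fderiv
    rw [h3]
    refine (ContinuousLinearMap.opNorm_comp_le _ _).trans ?_
    refine mul_le_mul (hC _) ?_ (norm_nonneg _) C0
    · rw [norm_smul, Real.norm_of_nonneg (by positivity)]
      exact mul_le_of_le_one_right (by positivity) ContinuousLinearMap.norm_id_le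
  · intro n; have := hn n; positivity
  · have := (tendsto_one_div_add_atTop_nhds_zero_nat (𝕜 := ℝ)).const_mul C
    simpa using this
  · intro x
    filter_upwards [Filter.eventually_ge_atTop ⌈‖x‖⌉₊] with n hx
    apply f.one_of_mem_closedBall
    have h1 : ‖x‖ ≤ n := Nat.ceil_le.1 hx
    rw [mem_closedBall_zero_iff, norm_smul, Real.norm_of_nonneg (by have := hn n; positivity),
      inv_mul_le_iff₀ (hn n)]
    show ‖x‖ ≤ (n + 1) * 1
    linarith

/-- For `u ∈ C²` with `|∇u| ∈ L²(π)` and Hessian Frobenius norm in `L²(π)`: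
`∫ |∇u|²|∇U|² dπ ≤ 16 ∫ ‖∇²u‖_F² dπ + 4 C_U d^{1+ω} ∫ |∇u|² dπ`. -/
theorem stmt4 (d : ℕ) (hd : 1 ≤ d) (U : EuclideanSpace ℝ (Fin d) → ℝ)
    (hU : ContDiff ℝ 2 U)
    (hIntU : Integrable (fun x => Real.exp (-U x)))
    (Z : ℝ) (hZ : Z = ∫ x, Real.exp (-U x))
    (C_U ω : ℝ) (hCU : 0 < C_U) (hω : 0 ≤ ω)
    (hLap : ∀ x, lapl d U x ≤ C_U * (d : ℝ) ^ ((1 : ℝ) + ω) + ‖gradient U x‖ ^ 2 / 2)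
    (u : EuclideanSpace ℝ (Fin d) → ℝ) (hu : ContDiff ℝ 2 u)
    (hgradu2 : Integrable (fun x => ‖gradient u x‖ ^ 2) (gibbs d U Z))
    (hhess2 : Integrable (fun x => hessFS d u x) (gibbs d U Z)) :
    ∫⁻ x, ENNReal.ofReal (‖gradient u x‖ ^ 2 * ‖gradient U x‖ ^ 2) ∂(gibbs d U Z)
      ≤ ENNReal.ofReal (16 * ∫ x, hessFS d u x ∂(gibbs d U Z)
          + 4 * C_U * (d : ℝ) ^ ((1 : ℝ) + ω)
            * ∫ x, ‖gradient u x‖ ^ 2 ∂(gibbs d U Z)) := by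
  have hUc := hU.continuous
  have hZ0 : 0 < Z := by
    rw [hZ]
    exact integral_exp_pos hIntU
  obtain ⟨χ, ε, h1, h2, h3, h4, h5, h6, h7, h8⟩ := exists_cutoff d
  set K := C_U * (d : ℝ) ^ ((1 : ℝ) + ω) with hKdef
  have hK : 0 ≤ K := by positivity
  have main := fun n => cutoff_ineq d U u (χ n) Z K (ε n) hU hZ0 hK (h6 n) hLap hu hgradu2 hhess2
    (h1 n) (h2 n) (h3 n) (h4 n) (h5 n)
  set IH := ∫ x, hessFS d u x ∂(gibbs d U Z)
  set IG := ∫ x, ‖gradient u x‖ ^ 2 ∂(gibbs d U Z)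
  have hlim : Filter.Tendsto (fun n => ENNReal.ofReal (16 * (1 + ε n) * IH
      + (16 * (ε n ^ 2 + ε n) + 4 * K) * IG)) Filter.atTop
      (nhds (ENNReal.ofReal (16 * IH + 4 * C_U * (d : ℝ) ^ ((1 : ℝ) + ω) * IG))) := by
    refine ENNReal.tendsto_ofReal ?_
    have e : 16 * IH + 4 * C_U * (d : ℝ) ^ ((1 : ℝ) + ω) * IG
      = 16 * (1 + 0) * IH + (16 * ((0 : ℝ) ^ 2 + 0) + 4 * K) * IG := by rw [hKdef]; ring
    rw [e]
    exact (((h7.const_add 1).const_mul 16).mul_const IH).add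
      (((((h7.pow 2).add h7).const_mul 16).add_const (4 * K)).mul_const IG)
  have hn : ∀ n, ∫⁻ x, ENNReal.ofReal (χ n x ^ 2 * (‖gradient u x‖ ^ 2 * ‖gradient U x‖ ^ 2))
      ∂(gibbs d U Z) ≤ ENNReal.ofReal (16 * (1 + ε n) * IH
        + (16 * (ε n ^ 2 + ε n) + 4 * K) * IG) := by
    intro n
    rw [← ofReal_integral_eq_lintegral_ofReal (main n).1
      (Filter.Eventually.of_forall fun x => by simp only [Pi.zero_apply]; positivity)]
    exact ENNReal.ofReal_le_ofReal (main n).2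
  have hfatou := lintegral_liminf_le' (μ := gibbs d U Z) (u := Filter.atTop)
    (f := fun n x => ENNReal.ofReal (χ n x ^ 2 * (‖gradient u x‖ ^ 2 * ‖gradient U x‖ ^ 2)))
    (fun n => (main n).1.aestronglyMeasurable.aemeasurable.ennreal_ofReal)
  have hpt : ∀ x, Filter.liminf (fun n => ENNReal.ofReal
      (χ n x ^ 2 * (‖gradient u x‖ ^ 2 * ‖gradient U x‖ ^ 2))) Filter.atTop
      = ENNReal.ofReal (‖gradient u x‖ ^ 2 * ‖gradient U x‖ ^ 2) := by
    intro x
    refine Filter.Tendsto.liminf_eq (tendsto_const_nhds.congr' ?_)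
    filter_upwards [h8 x] with n hx
    simp [hx]
  simp only [hpt] at hfatou
  refine hfatou.trans ?_
  rw [← hlim.liminf_eq]
  exact Filter.liminf_le_liminf (Filter.Eventually.of_forall hn)
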